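/- For k ≥ 3, let n = 3k − 1 and let F_n be the fan graph, i.e., the join of the path P_n (with vertices v_1,…,v_n in order) and a single vertex u. Let e = u v_n be the edge joining u to an end vertex of the path. Then gp(F_n − e) = 2k − 1 = gp(F_n) − 1. -/

import Mathlib

open SimpleGraph

/-- `S` is a *general position set* of `G`: no three distinct vertices of `S`
lie on a common shortest path (geodesic) of `G`. -/
def IsGPSet {V : Type*} (G : SimpleGraph V) (S : Set V) : Prop :=
  ∀ ⦃u v w : V⦄, u ∈ S → v ∈ S → w ∈ S → u ≠ v → u ≠ w → v ≠ w →
    ∀ p : G.Walk u v, p.IsPath → p.length = G.dist u v → w ∉ p.support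

/-- The *general position number* of `G`: the maximum cardinality of a
general position set. -/
noncomputable def gpNum {V : Type*} [Fintype V] (G : SimpleGraph V) : ℕ :=
  sSup {n : ℕ | ∃ S : Finset V, IsGPSet G ↑S ∧ S.card = n}

/-- The vertex-deleted subgraph `G - x`, induced on `V(G) \ {x}`. -/
def delVert {V : Type*} (G : SimpleGraph V) (x : V) : SimpleGraph {y : V // y ≠ x} :=
  G.comap Subtype.val

/-- The fan graph `F_n`: the join of the path `P_n` (vertices `some i`,
`i : Fin n`, with `v_j` corresponding to `i = j - 1`, consecutive indices
adjacent) and a single vertex `u = none` adjacent to all path vertices. -/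
def fan (n : ℕ) : SimpleGraph (Option (Fin n)) :=
  SimpleGraph.fromRel (fun a b =>
    (a = none ∧ b ≠ none) ∨
    (∃ i j : Fin n, a = some i ∧ b = some j ∧ (i : ℕ) + 1 = (j : ℕ)))

namespace FanAux

lemma fan_some_some {n : ℕ} (i j : Fin n) :
    (fan n).Adj (some i) (some j) ↔ (i : ℕ) + 1 = j ∨ (j : ℕ) + 1 = i := by
  unfold fan
  rw [SimpleGraph.fromRel_adj]
  constructor
  · rintro ⟨h, h1 | h1⟩
    · rcases h1 with h1 | ⟨a, b, ha, hb, hab⟩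
      · simp at h1
      · cases ha; cases hb; exact Or.inl hab
    · rcases h1 with h1 | ⟨a, b, ha, hb, hab⟩
      · simp at h1
      · cases ha; cases hb; exact Or.inr hab
  · rintro (h | h)
    · refine ⟨?_, Or.inl (Or.inr ⟨i, j, rfl, rfl, h⟩)⟩
      intro e; cases e; omega
    · refine ⟨?_, Or.inr (Or.inr ⟨j, i, rfl, rfl, h⟩)⟩
      intro e; cases e; omega

lemma fan_none_some {n : ℕ} (j : Fin n) : (fan n).Adj none (some j) := by
  unfold fan
  rw [SimpleGraph.fromRel_adj]
  exact ⟨by simp, Or.inl (Or.inl ⟨rfl, by simp⟩)⟩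

/-- A middle vertex of an induced path on three vertices is forbidden. -/
lemma no_induced {V : Type*} {G : SimpleGraph V} {S : Set V} (hS : IsGPSet G S)
    {a b c : V} (ha : a ∈ S) (hb : b ∈ S) (hc : c ∈ S) (hab : G.Adj a b) (hbc : G.Adj b c)
    (hac : a ≠ c) (hn : ¬ G.Adj a c) : False := by
  let p : G.Walk a c := .cons hab (.cons hbc .nil)
  have hp : p.length = 2 := rfl
  have hd : G.dist a c = 2 := by
    have h1 : G.dist a c ≤ 2 := hp ▸ SimpleGraph.dist_le p
    have h0 : G.dist a c ≠ 0 := by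
      intro h
      exact hac ((Walk.reachable p).dist_eq_zero_iff.mp h)
    have h2 : G.dist a c ≠ 1 := by
      intro h
      exact hn (SimpleGraph.dist_eq_one_iff_adj.mp h)
    omega
  refine hS ha hc hb hac hab.ne hbc.ne' p ?_ (by rw [hp, hd]) (by simp [p])
  simp [p, Walk.cons_isPath_iff, hab.ne, hbc.ne, hac]

/-- The unique neighbour of a pendant vertex is forbidden together with it. -/
lemma no_pendant {V : Type*} {G : SimpleGraph V} {S : Set V} (hS : IsGPSet G S)
    {x y z : V} (hx : x ∈ S) (hy : y ∈ S) (hz : z ∈ S) (hxy : x ≠ y) (hxz : x ≠ z) (hyz : y ≠ z)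
    (hu : ∀ w, G.Adj x w → w = y) (hr : G.Reachable x z) : False := by
  obtain ⟨p, hp, hl⟩ := hr.exists_path_of_dist
  refine hS hx hz hy hxz hxy hyz.symm p hp hl ?_
  cases p with
  | nil => exact absurd rfl hxz
  | cons h q =>
    have := hu _ h
    subst this
    simp

/-- A sufficient condition for being a general position set. -/
lemma gp_of {V : Type*} {G : SimpleGraph V} {S : Set V}
    (hd : ∀ a ∈ S, ∀ b ∈ S, G.dist a b ≤ 2)
    (h3 : ∀ a ∈ S, ∀ b ∈ S, ∀ c ∈ S, a ≠ c → G.Adj a b → G.Adj b c → False) :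
    IsGPSet G S := by
  intro u v w hu hv hw huv huw hvw p hp hl hmem
  have hle := hd u hu v hv
  rw [← hl] at hle
  cases p with
  | nil => exact huv rfl
  | cons h q =>
    cases q with
    | nil => simp at hmem; rcases hmem with h | h <;> simp_all
    | cons h' r =>
      cases r with
      | nil =>
        simp at hmem
        rcases hmem with rfl | rfl | rfl
        · exact huw rfl
        · exact h3 _ hu _ hw _ hv huv h h'
        · exact hvw rfl
      | cons h'' s => simp at hle

lemma card_bound (m : ℕ) : ∀ T : Finset ℕ, (∀ i ∈ T, i < 3 * m) →
    (∀ i, i ∈ T → i + 1 ∈ T → i + 2 ∈ T → False) → T.card ≤ 2 * m := by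
  induction m with
  | zero =>
    intro T hT _
    have : T = ∅ := Finset.eq_empty_of_forall_notMem (fun i hi => by have := hT i hi; omega)
    simp [this]
  | succ m ih =>
    intro T hT h3
    have h1 := ih (T.filter (· < 3 * m)) (by simp) (by
      intro i a b c
      simp only [Finset.mem_filter] at a b c
      exact h3 i a.1 b.1 c.1)
    have h2 : (T.filter (¬ · < 3 * m)).card ≤ 2 := by
      by_contra hc
      have hsub : T.filter (¬ · < 3 * m) ⊆ {3 * m, 3 * m + 1, 3 * m + 2} := by
        intro i hi
        simp only [Finset.mem_filter] at hi
        have := hT i hi.1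
        simp only [Finset.mem_insert, Finset.mem_singleton]
        omega
      have he := Finset.eq_of_subset_of_card_le hsub (le_trans Finset.card_le_three (not_le.mp hc))
      have hm : ∀ j ∈ ({3 * m, 3 * m + 1, 3 * m + 2} : Finset ℕ), j ∈ T := by
        intro j hj
        rw [← he] at hj
        exact (Finset.mem_filter.mp hj).1
      exact h3 (3 * m) (hm _ (by simp)) (hm _ (by simp)) (hm _ (by simp))
    have := Finset.card_filter_add_card_filter_not (s := T) (· < 3 * m)
    omega

/-- The indices of the path vertices of `S`. -/
def idx {n : ℕ} (S : Finset (Option (Fin n))) : Finset ℕ := S.eraseNone.map Fin.valEmbedding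

lemma mem_idx {n : ℕ} (S : Finset (Option (Fin n))) (i : ℕ) :
    i ∈ idx S ↔ ∃ h : i < n, some (⟨i, h⟩ : Fin n) ∈ S := by
  simp only [idx, Finset.mem_map, Finset.mem_eraseNone, Fin.valEmbedding_apply]
  constructor
  · rintro ⟨a, ha, rfl⟩
    exact ⟨a.2, ha⟩
  · rintro ⟨h, hS⟩
    exact ⟨⟨i, h⟩, hS, rfl⟩

lemma card_idx {n : ℕ} (S : Finset (Option (Fin n))) (h : none ∉ S) :
    (idx S).card = S.card := by
  have := Finset.card_eraseNone_of_not_mem h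
  simp [idx, this]

/-- The extremal pattern: two vertices taken, one skipped, and so on. -/
def pat (k m : ℕ) (hm : m ≤ 2 * k) : Fin m ↪ Option (Fin (3 * k - 1)) where
  toFun i := some ⟨3 * (i.1 / 2) + i.1 % 2, by omega⟩
  inj' a b h := by
    simp only [Option.some.injEq, Fin.mk.injEq] at h
    ext; omega

lemma mem_pat {k m : ℕ} {hm : m ≤ 2 * k} {a : Option (Fin (3 * k - 1))}
    (h : a ∈ ((Finset.univ.map (pat k m hm) : Finset _) : Set (Option (Fin (3 * k - 1))))) :
    ∃ i : Fin (3 * k - 1), a = some i ∧ i.1 % 3 ≠ 2 ∧ 2 * (i.1 / 3) + i.1 % 3 < m := by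
  simp only [Finset.coe_map, Finset.coe_univ, Set.image_univ, Set.mem_range] at h
  obtain ⟨j, rfl⟩ := h
  exact ⟨_, rfl, by dsimp only; omega, by dsimp only; omega⟩

lemma dist_le_two {V : Type*} {G : SimpleGraph V} {a b c : V} (h : G.Adj a b) (h' : G.Adj b c) :
    G.dist a c ≤ 2 := SimpleGraph.dist_le (Walk.cons h (Walk.cons h' Walk.nil))

lemma gp_pat {k m : ℕ} {hm : m ≤ 2 * k} (G : SimpleGraph (Option (Fin (3 * k - 1))))
    (hG : G ≤ fan (3 * k - 1))
    (hu : ∀ i : Fin (3 * k - 1), i.1 % 3 ≠ 2 → 2 * (i.1 / 3) + i.1 % 3 < m →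
      G.Adj none (some i)) :
    IsGPSet G ((Finset.univ.map (pat k m hm) : Finset _) : Set (Option (Fin (3 * k - 1)))) := by
  apply gp_of
  · intro a ha b hb
    obtain ⟨i, rfl, hi, hi'⟩ := mem_pat ha
    obtain ⟨j, rfl, hj, hj'⟩ := mem_pat hb
    exact dist_le_two (hu i hi hi').symm (hu j hj hj')
  · intro a ha b hb c hc hac hab hbc
    obtain ⟨i, rfl, hi, hi'⟩ := mem_pat ha
    obtain ⟨j, rfl, hj, hj'⟩ := mem_pat hb
    obtain ⟨l, rfl, hl, hl'⟩ := mem_pat hc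
    have h1 := (fan_some_some _ _).mp (hG hab)
    have h2 := (fan_some_some _ _).mp (hG hbc)
    have h3 : i.1 ≠ l.1 := fun h => hac (by rw [Fin.ext h])
    omega

lemma gpNum_eq {V : Type*} [Fintype V] {G : SimpleGraph V} {m : ℕ}
    (h1 : ∃ S : Finset V, IsGPSet G ↑S ∧ S.card = m)
    (h2 : ∀ S : Finset V, IsGPSet G ↑S → S.card ≤ m) : gpNum G = m := by
  apply IsGreatest.csSup_eq
  refine ⟨h1, ?_⟩
  rintro _ ⟨S, hS, rfl⟩
  exact h2 S hS

/-- If the hub is in `S` then `S` is small. -/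
lemma hub_bound {n : ℕ} (hn : 0 < n) (G : SimpleGraph (Option (Fin n))) (hG : G ≤ fan n)
    (hu : ∀ i : Fin n, i.1 ≠ n - 1 → G.Adj none (some i))
    (S : Finset (Option (Fin n))) (hS : IsGPSet G (S : Set (Option (Fin n)))) (h : none ∈ S) :
    S.card ≤ 4 := by
  have key : ((S.erase none).erase (some ⟨n - 1, by omega⟩)).card ≤ 2 := by
    by_contra hc
    push Not at hc
    obtain ⟨a, b, c, ha, hb, hc, hab, hac, hbc⟩ := Finset.two_lt_card_iff.mp hc
    have hx : ∀ x ∈ (S.erase none).erase (some ⟨n - 1, by omega⟩),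
        ∃ i : Fin n, x = some i ∧ i.1 ≠ n - 1 ∧ some i ∈ S := by
      intro x hx
      simp only [Finset.mem_erase] at hx
      cases x with
      | none => exact absurd rfl hx.2.1
      | some i => exact ⟨i, rfl, fun h => hx.1 (by rw [Option.some.injEq]; exact Fin.ext h), hx.2.2⟩
    obtain ⟨i, rfl, hi, hi'⟩ := hx a ha
    obtain ⟨j, rfl, hj, hj'⟩ := hx b hb
    obtain ⟨l, rfl, hl, hl'⟩ := hx c hc
    have adj : ∀ i j : Fin n, i.1 ≠ n - 1 → some i ∈ S → j.1 ≠ n - 1 → some j ∈ S →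
        some i ≠ some j → i.1 + 1 = j ∨ j.1 + 1 = i := by
      intro i j hi hi' hj hj' hij
      by_contra hcon
      exact no_induced hS hi' h hj' (hu i hi).symm (hu j hj) hij
        (fun hA => hcon ((fan_some_some _ _).mp (hG hA)))
    have h1 := adj i j hi hi' hj hj' hab
    have h2 := adj i l hi hi' hl hl' hac
    have h3 := adj j l hj hj' hl hl' hbc
    omega
  have h1 := Finset.pred_card_le_card_erase (s := S) (a := none)
  have h2 := Finset.pred_card_le_card_erase (s := S.erase none) (a := some ⟨n - 1, by omega⟩)
  omega

/-- No three consecutive path vertices. -/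
lemma no_three {n : ℕ} (G : SimpleGraph (Option (Fin n))) (hG : G ≤ fan n)
    (hp : ∀ i j : Fin n, i.1 + 1 = j.1 → G.Adj (some i) (some j))
    (S : Finset (Option (Fin n))) (hS : IsGPSet G (S : Set (Option (Fin n)))) (i : ℕ)
    (h0 : i ∈ idx S) (h1 : i + 1 ∈ idx S) (h2 : i + 2 ∈ idx S) : False := by
  rw [mem_idx] at h0 h1 h2
  obtain ⟨a, ha⟩ := h0
  obtain ⟨b, hb⟩ := h1
  obtain ⟨c, hc⟩ := h2
  refine no_induced hS ha hb hc (hp _ _ rfl) (hp _ _ rfl) (by simp) ?_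
  intro hA
  have := (fan_some_some _ _).mp (hG hA)
  dsimp only at this
  omega

lemma gp_fan (k : ℕ) (hk : 3 ≤ k) : gpNum (fan (3 * k - 1)) = 2 * k := by
  apply gpNum_eq
  · exact ⟨Finset.univ.map (pat k (2 * k) le_rfl),
      gp_pat _ le_rfl (fun i _ _ => fan_none_some i), by simp⟩
  · intro S hS
    by_cases h : none ∈ S
    · have := hub_bound (by omega) _ le_rfl (fun i _ => fan_none_some i) S hS h
      omega
    · rw [← card_idx S h]
      apply card_bound
      · intro i hi
        obtain ⟨hi, _⟩ := (mem_idx _ _).mp hi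
        omega
      · exact no_three _ le_rfl (fun i j hij => (fan_some_some _ _).mpr (Or.inl hij)) S hS

lemma gp_del (k : ℕ) (hk : 3 ≤ k) (l : Fin (3 * k - 1)) (hl : l.1 = 3 * k - 2) :
    gpNum ((fan (3 * k - 1)).deleteEdges {s((none : Option (Fin (3 * k - 1))), some l)})
      = 2 * k - 1 := by
  set G := (fan (3 * k - 1)).deleteEdges {s((none : Option (Fin (3 * k - 1))), some l)} with hGdef
  have hG : G ≤ fan (3 * k - 1) := SimpleGraph.deleteEdges_le _
  have hp : ∀ i j : Fin (3 * k - 1), i.1 + 1 = j.1 → G.Adj (some i) (some j) := by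
    intro i j hij
    rw [hGdef, SimpleGraph.deleteEdges_adj]
    exact ⟨(fan_some_some _ _).mpr (Or.inl hij), by simp⟩
  have hu : ∀ i : Fin (3 * k - 1), i ≠ l → G.Adj none (some i) := by
    intro i hi
    rw [hGdef, SimpleGraph.deleteEdges_adj]
    exact ⟨fan_none_some i, by simp [hi]⟩
  have hnl : ¬ G.Adj none (some l) := by
    rw [hGdef, SimpleGraph.deleteEdges_adj]
    simp
  apply gpNum_eq
  · refine ⟨Finset.univ.map (pat k (2 * k - 1) (by omega)), gp_pat _ hG ?_, by simp⟩
    intro i h1 h2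
    apply hu
    rintro rfl
    omega
  · intro S hS
    by_cases h : none ∈ S
    · have := hub_bound (by omega) _ hG
        (fun i hi => hu i (by rintro rfl; omega)) S hS h
      omega
    · have h3 := no_three _ hG hp S hS
      by_contra hc
      push Not at hc
      have hcard := card_idx S h
      have hlt : ∀ i ∈ idx S, i < 3 * k - 1 := fun i hi => ((mem_idx _ _).mp hi).1
      have hb := card_bound (k - 1) ((idx S).filter (· < 3 * (k - 1))) (by simp) (by
        intro i a b c
        simp only [Finset.mem_filter] at a b c
        exact h3 i a.1 b.1 c.1)
      have hboth : ∀ x y : ℕ, (x = 3 * k - 3 ∧ y = 3 * k - 2 ∨ x = 3 * k - 2 ∧ y = 3 * k - 3) →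
          y ∈ idx S := by
        intro x y hxy
        by_contra hy
        have hsub : idx S ⊆ insert x ((idx S).filter (· < 3 * (k - 1))) := by
          intro i hi
          have := hlt i hi
          simp only [Finset.mem_insert, Finset.mem_filter]
          have : i ≠ y := by rintro rfl; exact hy hi
          by_cases hix : i = x
          · exact Or.inl hix
          · exact Or.inr ⟨hi, by omega⟩
        have := (Finset.card_le_card hsub).trans (Finset.card_insert_le _ _)
        omega
      obtain ⟨q1, m1⟩ := (mem_idx _ _).mp (hboth (3 * k - 2) (3 * k - 3) (Or.inr ⟨rfl, rfl⟩))
      obtain ⟨q2, m2⟩ := (mem_idx _ _).mp (hboth (3 * k - 3) (3 * k - 2) (Or.inl ⟨rfl, rfl⟩))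
      have hl' : l = ⟨3 * k - 2, q2⟩ := Fin.ext hl
      rw [← hl'] at m2
      obtain ⟨z, hz, hz1⟩ : ∃ z ∈ S, z ∉ ({some l, some ⟨3 * k - 3, q1⟩} : Finset _) := by
        apply Finset.exists_mem_notMem_of_card_lt_card
        have := Finset.card_le_two (a := some l) (b := some (⟨3 * k - 3, q1⟩ : Fin (3 * k - 1)))
        omega
      simp only [Finset.mem_insert, Finset.mem_singleton, not_or] at hz1
      have hadj : G.Adj (some ⟨3 * k - 3, q1⟩) (some l) := hp _ _ (by dsimp only; omega)
      refine no_pendant hS m2 m1 hz hadj.ne' (Ne.symm hz1.1) (Ne.symm hz1.2) ?_ ?_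
      · intro w hw
        cases w with
        | none => exact absurd hw.symm hnl
        | some i =>
          have := (fan_some_some _ _).mp (hG hw)
          rw [Option.some.injEq]
          apply Fin.ext
          dsimp only
          omega
      · have r1 : G.Reachable (some l) none :=
          hadj.symm.reachable.trans
            (hu _ (by intro e; rw [← e] at hl; dsimp only at hl; omega)).symm.reachable
        cases z with
        | none => exact r1
        | some i => exact r1.trans (hu i (by rintro rfl; exact hz1.1 rfl)).reachable

end FanAux

/-- For `k ≥ 3` and `n = 3k - 1`, with `e = u v_n` the edge
joining the hub `u` to the end vertex `v_n` of the path,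
`gp(F_n - e) = 2k - 1 = gp(F_n) - 1`. -/
theorem stmt_17 (k : ℕ) (hk : 3 ≤ k) :
    gpNum ((fan (3 * k - 1)).deleteEdges
        {s((none : Option (Fin (3 * k - 1))), some ⟨3 * k - 2, by omega⟩)})
      = 2 * k - 1 ∧
    2 * k - 1 = gpNum (fan (3 * k - 1)) - 1 := by
  refine ⟨FanAux.gp_del k hk _ rfl, ?_⟩
  rw [FanAux.gp_fan k hk]
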